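/- arXiv:2410.05606 — 3 statements merged into one kernel-verified Lean document; each statement's English description precedes it below -/
import Mathlib

section
/- For all real numbers a > 0, b > 0 and c₁ ≥ 0, c₂ ≥ 0, one has arsinh(cosh(c₁)/sinh(a)) + arsinh(cosh(c₂)/sinh(b)) ≤ arsinh(1/sinh(a)) + arsinh(1/sinh(b)) + c₁ + c₂. -/
theorem Real.arsinh_mul_cosh_le (y : ℝ) {c : ℝ} (hc : 0 ≤ c) :
    Real.arsinh (y * Real.cosh c) ≤ Real.arsinh y + c := by
  rw [← Real.sinh_le_sinh, Real.sinh_add, Real.sinh_arsinh, Real.sinh_arsinh]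
  exact le_add_of_nonneg_right
    (mul_nonneg (Real.cosh_pos _).le (Real.sinh_nonneg_iff.mpr hc))

/-- Upper bound in the orthodistance lemma for a hyperbolic pair of pants. -/
theorem orthodistance_upper_bound (a b c₁ c₂ : ℝ) (ha : 0 < a) (hb : 0 < b)
    (hc₁ : 0 ≤ c₁) (hc₂ : 0 ≤ c₂) :
    Real.arsinh (Real.cosh c₁ / Real.sinh a) + Real.arsinh (Real.cosh c₂ / Real.sinh b) ≤
      Real.arsinh (1 / Real.sinh a) + Real.arsinh (1 / Real.sinh b) + c₁ + c₂ := by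
  have h₁ := Real.arsinh_mul_cosh_le (1 / Real.sinh a) hc₁
  have h₂ := Real.arsinh_mul_cosh_le (1 / Real.sinh b) hc₂
  rw [one_div_mul_eq_div] at h₁ h₂
  linarith
end

section
/- The series over natural numbers n ≥ 2 of arsinh(1/sinh(2·log n)) + arsinh(1/sinh(2·log n + 1)) converges (i.e., the function n ↦ arsinh(1/sinh(2·log n)) + arsinh(1/sinh(2·log n + 1)) is summable). -/
theorem Real.arsinh_le_self {x : ℝ} (hx : 0 ≤ x) : Real.arsinh x ≤ x := by
  simpa only [Real.sinh_arsinh] using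
    Real.self_le_sinh_iff.mpr (Real.arsinh_nonneg_iff.mpr hx)

theorem Real.arsinh_one_div_sinh_le {x : ℝ} (hx : Real.log 2 ≤ x) :
    Real.arsinh (1 / Real.sinh x) ≤ 4 * Real.exp (-x) := by
  have h2 : 2 ≤ Real.exp x := (Real.log_le_iff_le_exp two_pos).mp hx
  have hmul : Real.exp x * Real.exp (-x) = 1 := by rw [← Real.exp_add]; simp
  have hpos := Real.exp_pos (-x)
  have hsinh : Real.exp x / 4 ≤ Real.sinh x := by
    rw [Real.sinh_eq]
    nlinarith
  have hsinh_pos : 0 < Real.sinh x := by linarith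
  refine (Real.arsinh_le_self (one_div_pos.mpr hsinh_pos).le).trans ?_
  rw [div_le_iff₀ hsinh_pos]
  nlinarith

/-- The series over `n ≥ 2` of `arsinh (1/sinh (2 log n)) + arsinh (1/sinh (2 log n + 1))`
converges. -/
theorem summable_collar_widths :
    Summable (fun n : {n : ℕ // 2 ≤ n} =>
      Real.arsinh (1 / Real.sinh (2 * Real.log (n : ℕ))) +
        Real.arsinh (1 / Real.sinh (2 * Real.log (n : ℕ) + 1))) := by
  have hsum : Summable (fun n : {n : ℕ // 2 ≤ n} => 8 * (1 / ((n : ℕ) : ℝ) ^ 2)) :=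
    ((Real.summable_one_div_nat_pow.mpr one_lt_two).comp_injective
      Subtype.val_injective).mul_left 8
  refine hsum.of_nonneg_of_le (fun ⟨n, hn⟩ => ?_) (fun ⟨n, hn⟩ => ?_)
  · have hlog : 0 ≤ Real.log n := Real.log_natCast_nonneg n
    refine add_nonneg ?_ ?_ <;>
      exact Real.arsinh_nonneg_iff.mpr
        (one_div_nonneg.mpr (Real.sinh_nonneg_iff.mpr (by positivity)))
  · have hn' : (2 : ℝ) ≤ n := by exact_mod_cast hn
    have hlog : Real.log 2 ≤ Real.log n := Real.log_le_log two_pos hn'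
    have hlog_two : 0 < Real.log 2 := Real.log_pos one_lt_two
    have hexp : Real.exp (-(2 * Real.log n)) = 1 / (n : ℝ) ^ 2 := by
      rw [Real.exp_neg, two_mul, Real.exp_add, Real.exp_log (by linarith), one_div, sq]
    have hfst := Real.arsinh_one_div_sinh_le (x := 2 * Real.log n) (by linarith)
    have hsnd := Real.arsinh_one_div_sinh_le (x := 2 * Real.log n + 1) (by linarith)
    have hmono : Real.exp (-(2 * Real.log n + 1)) ≤ Real.exp (-(2 * Real.log n)) :=
      Real.exp_le_exp.mpr (by linarith)
    rw [← hexp]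
    linarith
end

section
/- For any two points z, w : ℕ → ℝ of the countable product ℝ^ℕ equipped with the product topology, there exists a continuous path L : [0,1] → (ℕ → ℝ) with L(0) = z and L(1) = w such that: (i) for every t ∈ [0,1), the set { n : L(t)(n) ≠ z(n) } is finite; and (ii) for every t ∈ [0,1] and every n, the value L(t)(n) lies in the closed segment between z(n) and w(n). -/
/-- The piecewise linear ramp that rises from `0` to `1` on `[1 - 1/(n+1), 1 - 1/(n+2)]`. -/
noncomputable def zigzagRamp (n : ℕ) (t : ℝ) : ℝ :=
  max 0 (min 1 ((n + 2) * (1 - (n + 1) * (1 - t))))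

theorem continuous_zigzagRamp (n : ℕ) : Continuous (zigzagRamp n) := by
  unfold zigzagRamp
  fun_prop

theorem zigzagRamp_mem_Icc (n : ℕ) (t : ℝ) : zigzagRamp n t ∈ Set.Icc (0 : ℝ) 1 :=
  ⟨le_max_left _ _, max_le zero_le_one (min_le_left _ _)⟩

theorem zigzagRamp_eq_zero {n : ℕ} {t : ℝ} (h : 1 ≤ (n + 1) * (1 - t)) : zigzagRamp n t = 0 :=
  max_eq_left <| (min_le_right _ _).trans <|
    mul_nonpos_of_nonneg_of_nonpos (by positivity) (by linarith)

theorem zigzagRamp_zero (n : ℕ) : zigzagRamp n 0 = 0 :=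
  zigzagRamp_eq_zero (by simp)

theorem zigzagRamp_one (n : ℕ) : zigzagRamp n 1 = 1 := by
  have h : (1 : ℝ) ≤ n + 2 := by linarith [n.cast_nonneg (α := ℝ)]
  simp [zigzagRamp, h]

theorem finite_setOf_zigzagRamp_ne_zero {t : ℝ} (ht : t < 1) :
    {n : ℕ | zigzagRamp n t ≠ 0}.Finite := by
  obtain ⟨N, hN⟩ := exists_nat_gt (1 / (1 - t))
  have ht' : 0 < 1 - t := sub_pos.2 ht
  refine (Set.finite_lt_nat N).subset fun n hn => ?_
  by_contra hnN
  have hNn : (N : ℝ) ≤ n := by exact_mod_cast not_lt.1 hnN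
  refine hn (zigzagRamp_eq_zero ?_)
  rw [← div_le_iff₀ ht']
  linarith

/-- Zig-zag paths in `ℝ^ℕ` with the product topology: any two points `z, w` are joined by a
continuous path `L : [0,1] → (ℕ → ℝ)` such that for each `t < 1` the point `L t` differs from
`z` in only finitely many coordinates, and every coordinate of `L t` stays in the closed
segment between the corresponding coordinates of `z` and `w`. -/
theorem zigzag_path_exists (z w : ℕ → ℝ) :
    ∃ L : ℝ → (ℕ → ℝ), ContinuousOn L (Set.Icc 0 1) ∧ L 0 = z ∧ L 1 = w ∧
      (∀ t ∈ Set.Ico (0 : ℝ) 1, {n : ℕ | L t n ≠ z n}.Finite) ∧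
      (∀ t ∈ Set.Icc (0 : ℝ) 1, ∀ n : ℕ, L t n ∈ Set.uIcc (z n) (w n)) := by
  refine ⟨fun t n => AffineMap.lineMap (z n) (w n) (zigzagRamp n t), ?_, ?_, ?_, ?_, ?_⟩
  · exact (continuous_pi fun n =>
      AffineMap.lineMap_continuous.comp (continuous_zigzagRamp n)).continuousOn
  · ext n
    simp [zigzagRamp_zero]
  · ext n
    simp [zigzagRamp_one]
  · refine fun t ht => (finite_setOf_zigzagRamp_ne_zero ht.2).subset fun n hn h => hn ?_
    simp [h]
  · intro t _ n
    rw [← segment_eq_uIcc, segment_eq_image_lineMap]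
    exact Set.mem_image_of_mem _ (zigzagRamp_mem_Icc n t)
end
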